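/- arXiv:2212.08174 — 3 statements merged into one kernel-verified Lean document; each statement's English description precedes it below -/
import Mathlib

section
/- Let V_s and V_t be nonempty finite sets, Z a type, B ≥ 0, and H a nonempty set of pair hypotheses h : Z × Z → ℝ with 0 ≤ h(z,z') ≤ B for all z, z' and all h ∈ H. Take the loss L(a,b) = |a − b| on ℝ. For each depth m ∈ ℕ let F_m^s : V_s → Z and F_m^t : V_t → Z be subtree representation maps, and let d(m) = sup_{h,h' ∈ H} | (1/|V_s|²) ∑_{(u,v) ∈ V_s × V_s} |h(F_m^s u, F_m^s v) − h'(F_m^s u, F_m^s v)| − (1/|V_t|²) ∑_{(u,v) ∈ V_t × V_t} |h(F_m^t u, F_m^t v) − h'(F_m^t u, F_m^t v)| |. Assume d is monotone nondecreasing and its Cesàro means M ↦ (1/(M+1)) ∑_{m=0}^{M} d(m) converge to S. Fix a final depth ℓ, write f_s = F_ℓ^s, f_t = F_ℓ^t, and let y_s : V_s × V_s → ℝ and y_t : V_t × V_t → ℝ be link labels with values in [0,B]. Then for all h, h_s, h_t ∈ H, (1/|V_t|²) ∑_{(u,v)} |h(f_t u, f_t v) − y_t(u,v)| ≤ (1/|V_s|²)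 ∑_{(u,v)} |h(f_s u, f_s v) − y_s(u,v)| + S + (1/|V_t|²) ∑_{(u,v)} |h_s(f_t u, f_t v) − h_t(f_t u, f_t v)| + (1/|V_s|²) ∑_{(u,v)} |y_s(u,v) − h_s(f_s u, f_s v)| + (1/|V_t|²) ∑_{(u,v)} |h_t(f_t u, f_t v) − y_t(u,v)|. -/
open Finset

/-- A monotone sequence is bounded above by the limit of its Cesàro means. -/
theorem Monotone.le_of_tendsto_cesaro {d : ℕ → ℝ} (hd : Monotone d) {S : ℝ}
    (hS : Filter.Tendsto (fun M : ℕ => (∑ m ∈ Finset.range (M + 1), d m) / (M + 1))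
      Filter.atTop (nhds S)) (l : ℕ) : d l ≤ S := by
  have hmin : Filter.Tendsto (fun m => min (d m) (d l)) Filter.atTop (nhds (d l)) :=
    tendsto_const_nhds.congr' <| by
      filter_upwards [Filter.eventually_ge_atTop l] with m hm
      exact (min_eq_right (hd hm)).symm
  refine le_of_tendsto_of_tendsto' (hmin.cesaro.comp (Filter.tendsto_add_atTop_nat 1)) hS ?_
  intro M
  simp only [Function.comp_apply, Nat.cast_add, Nat.cast_one, inv_mul_eq_div]
  gcongr
  exact min_le_left _ _

/-- The average of `|f - g|` over ordered pairs satisfies the triangle inequality. -/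
theorem pairAverage_abs_sub_le {V : Type*} [Fintype V] (f g k : V → V → ℝ) :
    (∑ u, ∑ v, |f u v - k u v|) / (Fintype.card V : ℝ) ^ 2 ≤
      (∑ u, ∑ v, |f u v - g u v|) / (Fintype.card V : ℝ) ^ 2
        + (∑ u, ∑ v, |g u v - k u v|) / (Fintype.card V : ℝ) ^ 2 := by
  simp only [← add_div, ← Finset.sum_add_distrib]
  gcongr
  exact abs_sub_le _ _ _

theorem pairAverage_abs_sub_nonneg {V : Type*} [Fintype V] (f g : V → V → ℝ) :
    0 ≤ (∑ u, ∑ v, |f u v - g u v|) / (Fintype.card V : ℝ) ^ 2 := by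
  positivity

theorem pairAverage_abs_sub_le_of_bounded {V : Type*} [Fintype V] [Nonempty V] {B : ℝ}
    {f g : V → V → ℝ} (hf : ∀ u v, 0 ≤ f u v ∧ f u v ≤ B) (hg : ∀ u v, 0 ≤ g u v ∧ g u v ≤ B) :
    (∑ u, ∑ v, |f u v - g u v|) / (Fintype.card V : ℝ) ^ 2 ≤ B := by
  have hcard : (0 : ℝ) < Fintype.card V := by exact_mod_cast Fintype.card_pos
  rw [div_le_iff₀ (by positivity)]
  calc ∑ u, ∑ v, |f u v - g u v| ≤ ∑ _u : V, ∑ _v : V, B := by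
        gcongr with u _ v _
        exact abs_sub_le_of_nonneg_of_le (hf u v).1 (hf u v).2 (hg u v).1 (hg u v).2
    _ = B * (Fintype.card V : ℝ) ^ 2 := by
        simp only [Finset.sum_const, Finset.card_univ, nsmul_eq_mul]
        ring

/-- Theorem 2 (cross-network link prediction bound): the target link prediction
error is bounded by the source error, the Graph Subtree Discrepancy `S`
(the limit of the Cesàro means of the per-depth base discrepancies `d` over
pair hypotheses with absolute-difference loss), the target disagreement of the
reference hypotheses `hs, ht`, and their respective source/target errors. -/
theorem cross_network_link_prediction_bound
    (Vs Vt : Type*) [Fintype Vs] [Fintype Vt] [Nonempty Vs] [Nonempty Vt]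
    (Z : Type*) (B : ℝ) (hB : 0 ≤ B)
    (H : Set (Z × Z → ℝ)) (hH : H.Nonempty)
    (hHbd : ∀ h ∈ H, ∀ z z' : Z, 0 ≤ h (z, z') ∧ h (z, z') ≤ B)
    (Fs : ℕ → Vs → Z) (Ft : ℕ → Vt → Z)
    (d : ℕ → ℝ)
    (hd : ∀ m, d m = sSup {x : ℝ | ∃ h ∈ H, ∃ h' ∈ H,
      x = |(∑ u : Vs, ∑ v : Vs, |h (Fs m u, Fs m v) - h' (Fs m u, Fs m v)|)
              / (Fintype.card Vs : ℝ) ^ 2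
          - (∑ u : Vt, ∑ v : Vt, |h (Ft m u, Ft m v) - h' (Ft m u, Ft m v)|)
              / (Fintype.card Vt : ℝ) ^ 2|})
    (hmono : Monotone d)
    (S : ℝ)
    (hS : Filter.Tendsto
      (fun M : ℕ => (∑ m ∈ Finset.range (M + 1), d m) / (M + 1))
      Filter.atTop (nhds S))
    (ℓ : ℕ) (fs : Vs → Z) (ft : Vt → Z)
    (hfs : fs = Fs ℓ) (hft : ft = Ft ℓ)
    (ys : Vs × Vs → ℝ) (yt : Vt × Vt → ℝ)
    (hys : ∀ p, 0 ≤ ys p ∧ ys p ≤ B) (hyt : ∀ p, 0 ≤ yt p ∧ yt p ≤ B) :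
    ∀ h ∈ H, ∀ hs ∈ H, ∀ ht ∈ H,
      (∑ u : Vt, ∑ v : Vt, |h (ft u, ft v) - yt (u, v)|)
          / (Fintype.card Vt : ℝ) ^ 2 ≤
        (∑ u : Vs, ∑ v : Vs, |h (fs u, fs v) - ys (u, v)|)
            / (Fintype.card Vs : ℝ) ^ 2
        + S
        + (∑ u : Vt, ∑ v : Vt, |hs (ft u, ft v) - ht (ft u, ft v)|)
            / (Fintype.card Vt : ℝ) ^ 2
        + (∑ u : Vs, ∑ v : Vs, |ys (u, v) - hs (fs u, fs v)|)
            / (Fintype.card Vs : ℝ) ^ 2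
        + (∑ u : Vt, ∑ v : Vt, |ht (ft u, ft v) - yt (u, v)|)
            / (Fintype.card Vt : ℝ) ^ 2 := by
  subst hfs hft
  intro h hh hs hhs ht hht
  have hdisc : |(∑ u : Vs, ∑ v : Vs, |h (Fs ℓ u, Fs ℓ v) - hs (Fs ℓ u, Fs ℓ v)|)
          / (Fintype.card Vs : ℝ) ^ 2
        - (∑ u : Vt, ∑ v : Vt, |h (Ft ℓ u, Ft ℓ v) - hs (Ft ℓ u, Ft ℓ v)|)
          / (Fintype.card Vt : ℝ) ^ 2| ≤ d ℓ := by
    rw [hd ℓ]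
    refine le_csSup ⟨B, ?_⟩ ⟨h, hh, hs, hhs, rfl⟩
    rintro x ⟨f, hf, g, hg, rfl⟩
    exact abs_sub_le_of_nonneg_of_le
      (pairAverage_abs_sub_nonneg (fun u v => f (Fs ℓ u, Fs ℓ v)) fun u v => g (Fs ℓ u, Fs ℓ v))
      (pairAverage_abs_sub_le_of_bounded (fun _ _ => hHbd f hf _ _) fun _ _ => hHbd g hg _ _)
      (pairAverage_abs_sub_nonneg (fun u v => f (Ft ℓ u, Ft ℓ v)) fun u v => g (Ft ℓ u, Ft ℓ v))
      (pairAverage_abs_sub_le_of_bounded (fun _ _ => hHbd f hf _ _) fun _ _ => hHbd g hg _ _)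
  have hlim := hmono.le_of_tendsto_cesaro hS ℓ
  have htarget := pairAverage_abs_sub_le (fun u v => h (Ft ℓ u, Ft ℓ v))
    (fun u v => hs (Ft ℓ u, Ft ℓ v)) fun u v => yt (u, v)
  have hreference := pairAverage_abs_sub_le (fun u v => hs (Ft ℓ u, Ft ℓ v))
    (fun u v => ht (Ft ℓ u, Ft ℓ v)) fun u v => yt (u, v)
  have hsource := pairAverage_abs_sub_le (fun u v => h (Fs ℓ u, Fs ℓ v))
    (fun u v => ys (u, v)) fun u v => hs (Fs ℓ u, Fs ℓ v)
  linarith [(abs_le.mp hdisc).1]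
end

section
/- Let V_s and V_t be nonempty finite sets, Z and Y types, B ≥ 0, and L : Y → Y → ℝ a loss with 0 ≤ L(a,b) ≤ B and L(a,c) ≤ L(a,b) + L(b,c) for all a,b,c ∈ Y. Let H be a nonempty set of hypotheses Z → Y, f_s : V_s → Z and f_t : V_t → Z feature maps, and y_s : V_s → Y, y_t : V_t → Y labelings. Define disc = sup_{h,h' ∈ H} | (1/|V_s|) ∑_{v ∈ V_s} L(h(f_s v), h'(f_s v)) − (1/|V_t|) ∑_{v ∈ V_t} L(h(f_t v), h'(f_t v)) |. Then for all h, h_s, h_t ∈ H, (1/|V_t|) ∑_{v ∈ V_t} L(h(f_t v), y_t v) ≤ (1/|V_s|) ∑_{v ∈ V_s} L(h(f_s v), y_s v) + disc + (1/|V_t|) ∑_{v ∈ V_t} L(h_s(f_t v), h_t(f_t v)) + (1/|V_s|) ∑_{v ∈ V_s} L(y_s v, h_s(f_s v)) + (1/|V_t|) ∑_{v ∈ V_t} L(h_t(f_t v), y_t v). -/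
open Finset

/-- A loss satisfying the triangle inequality still satisfies it after averaging. -/
theorem average_loss_triangle {V Y : Type*} [Fintype V] {L : Y → Y → ℝ}
    (hL : ∀ a b c, L a c ≤ L a b + L b c) (a b c : V → Y) :
    (∑ v, L (a v) (c v)) / (Fintype.card V : ℝ) ≤
      (∑ v, L (a v) (b v)) / (Fintype.card V : ℝ)
        + (∑ v, L (b v) (c v)) / (Fintype.card V : ℝ) := by
  rw [← add_div, ← Finset.sum_add_distrib]
  gcongr
  exact hL _ _ _

theorem average_loss_le {V Y : Type*} [Fintype V] [Nonempty V] {L : Y → Y → ℝ} {B : ℝ}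
    (hL : ∀ a b, L a b ≤ B) (a b : V → Y) :
    (∑ v, L (a v) (b v)) / (Fintype.card V : ℝ) ≤ B := by
  rw [div_le_iff₀ (by exact_mod_cast Fintype.card_pos), mul_comm, ← nsmul_eq_mul]
  exact Finset.sum_le_card_nsmul _ _ _ fun _ _ => hL _ _

theorem average_loss_nonneg {V Y : Type*} [Fintype V] {L : Y → Y → ℝ}
    (hL : ∀ a b, 0 ≤ L a b) (a b : V → Y) :
    0 ≤ (∑ v, L (a v) (b v)) / (Fintype.card V : ℝ) :=
  div_nonneg (Finset.sum_nonneg fun _ _ => hL _ _) (Nat.cast_nonneg _)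

/-- Core single-depth adaptation inequality inside the proof of Theorem 1:
the target classification error of a hypothesis `h` is bounded by its source
error, the empirical discrepancy distance `disc` between the source and target
feature distributions, the target disagreement of two reference hypotheses
`hs, ht`, and their respective errors on source and target. -/
theorem single_depth_adaptation_bound
    (Vs Vt : Type*) [Fintype Vs] [Fintype Vt] [Nonempty Vs] [Nonempty Vt]
    (Z Y : Type*) (B : ℝ) (hB : 0 ≤ B)
    (L : Y → Y → ℝ)
    (hL0 : ∀ a b, 0 ≤ L a b) (hLB : ∀ a b, L a b ≤ B)
    (hLtri : ∀ a b c, L a c ≤ L a b + L b c)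
    (H : Set (Z → Y)) (hH : H.Nonempty)
    (fs : Vs → Z) (ft : Vt → Z) (ys : Vs → Y) (yt : Vt → Y)
    (disc : ℝ)
    (hdisc : disc = sSup {x : ℝ | ∃ h ∈ H, ∃ h' ∈ H,
      x = |(∑ v : Vs, L (h (fs v)) (h' (fs v))) / (Fintype.card Vs)
          - (∑ v : Vt, L (h (ft v)) (h' (ft v))) / (Fintype.card Vt)|}) :
    ∀ h ∈ H, ∀ hs ∈ H, ∀ ht ∈ H,
      (∑ v : Vt, L (h (ft v)) (yt v)) / (Fintype.card Vt) ≤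
        (∑ v : Vs, L (h (fs v)) (ys v)) / (Fintype.card Vs)
        + disc
        + (∑ v : Vt, L (hs (ft v)) (ht (ft v))) / (Fintype.card Vt)
        + (∑ v : Vs, L (ys v) (hs (fs v))) / (Fintype.card Vs)
        + (∑ v : Vt, L (ht (ft v)) (yt v)) / (Fintype.card Vt) := by
  intro h hh hs hhs ht _
  have hbdd : BddAbove {x : ℝ | ∃ h ∈ H, ∃ h' ∈ H,
      x = |(∑ v : Vs, L (h (fs v)) (h' (fs v))) / (Fintype.card Vs)
          - (∑ v : Vt, L (h (ft v)) (h' (ft v))) / (Fintype.card Vt)|} := by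
    refine ⟨B, ?_⟩
    rintro _ ⟨g, _, g', _, rfl⟩
    have hs0 := average_loss_nonneg hL0 (fun v => g (fs v)) (fun v => g' (fs v))
    have ht0 := average_loss_nonneg hL0 (fun v => g (ft v)) (fun v => g' (ft v))
    have hsB := average_loss_le hLB (fun v => g (fs v)) (fun v => g' (fs v))
    have htB := average_loss_le hLB (fun v => g (ft v)) (fun v => g' (ft v))
    exact abs_sub_le_iff.2 ⟨by linarith, by linarith⟩
  have hle := (abs_sub_le_iff.1 (hdisc ▸ le_csSup hbdd ⟨h, hh, hs, hhs, rfl⟩)).2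
  have htri₁ := average_loss_triangle hLtri (fun v => h (ft v)) (fun v => hs (ft v)) yt
  have htri₂ := average_loss_triangle hLtri (fun v => hs (ft v)) (fun v => ht (ft v)) yt
  have htri₃ := average_loss_triangle hLtri (fun v => h (fs v)) ys (fun v => hs (fs v))
  linarith
end

section
/- Let X be a measurable space, μ and ν probability measures on X, B ≥ 0, and H a nonempty set of bounded measurable functions X → ℝ with |h(x)| ≤ B for all h ∈ H and x ∈ X. Let y : X → ℝ be a measurable function with |y(x)| ≤ B. Define disc(μ, ν) = sup_{h,h' ∈ H} | ∫ |h − h'| dμ − ∫ |h − h'| dν |. Then for all h, h_s, h_t ∈ H, ∫ |h − y| dν ≤ ∫ |h − y| dμ + disc(μ, ν) + ∫ |h_s − h_t| dν + ∫ |y − h_s| dμ + ∫ |h_t − y| dν. -/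
open MeasureTheory

lemma abs_sub_le_two_mul {a b B : ℝ} (ha : |a| ≤ B) (hb : |b| ≤ B) : |a - b| ≤ 2 * B :=
  (abs_sub a b).trans (by linarith)

lemma integrable_abs_sub_of_bounded {X : Type*} [MeasurableSpace X] (ρ : Measure X)
    [IsFiniteMeasure ρ] {B : ℝ} {f g : X → ℝ} (hf : Measurable f) (hg : Measurable g)
    (hfB : ∀ x, |f x| ≤ B) (hgB : ∀ x, |g x| ≤ B) :
    Integrable (fun x => |f x - g x|) ρ := by
  refine Integrable.abs (Integrable.sub ?_ ?_)
  · exact Integrable.of_bound hf.aestronglyMeasurable B (ae_of_all _ hfB)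
  · exact Integrable.of_bound hg.aestronglyMeasurable B (ae_of_all _ hgB)

lemma integral_abs_sub_le_two_mul {X : Type*} [MeasurableSpace X] (ρ : Measure X)
    [IsProbabilityMeasure ρ] {B : ℝ} {f g : X → ℝ} (hf : Measurable f) (hg : Measurable g)
    (hfB : ∀ x, |f x| ≤ B) (hgB : ∀ x, |g x| ≤ B) :
    ∫ x, |f x - g x| ∂ρ ≤ 2 * B := by
  simpa using integral_mono (integrable_abs_sub_of_bounded ρ hf hg hfB hgB)
    (integrable_const (2 * B)) fun x => abs_sub_le_two_mul (hfB x) (hgB x)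

lemma integral_abs_sub_triangle {X : Type*} [MeasurableSpace X] (ρ : Measure X)
    [IsFiniteMeasure ρ] {B : ℝ} {f g k : X → ℝ} (hf : Measurable f) (hg : Measurable g)
    (hk : Measurable k) (hfB : ∀ x, |f x| ≤ B) (hgB : ∀ x, |g x| ≤ B) (hkB : ∀ x, |k x| ≤ B) :
    ∫ x, |f x - k x| ∂ρ ≤ (∫ x, |f x - g x| ∂ρ) + ∫ x, |g x - k x| ∂ρ := by
  have hfg := integrable_abs_sub_of_bounded ρ hf hg hfB hgB
  have hgk := integrable_abs_sub_of_bounded ρ hg hk hgB hkB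
  rw [← integral_add hfg hgk]
  exact integral_mono (integrable_abs_sub_of_bounded ρ hf hk hfB hkB) (hfg.add hgk)
    fun x => abs_sub_le (f x) (g x) (k x)

/-- Measure-theoretic form of the generalization bound underlying Theorem 1,
with the base discrepancy instantiated by the discrepancy distance with loss
`L(a,b) = |a − b|`. -/
theorem measure_adaptation_bound
    (X : Type*) [MeasurableSpace X]
    (μ ν : Measure X) [IsProbabilityMeasure μ] [IsProbabilityMeasure ν]
    (B : ℝ) (hB : 0 ≤ B)
    (H : Set (X → ℝ)) (hH : H.Nonempty)
    (hHmeas : ∀ h ∈ H, Measurable h)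
    (hHbd : ∀ h ∈ H, ∀ x, |h x| ≤ B)
    (y : X → ℝ) (hymeas : Measurable y) (hybd : ∀ x, |y x| ≤ B)
    (disc : ℝ)
    (hdisc : disc = sSup {r : ℝ | ∃ h ∈ H, ∃ h' ∈ H,
      r = |(∫ x, |h x - h' x| ∂μ) - (∫ x, |h x - h' x| ∂ν)|}) :
    ∀ h ∈ H, ∀ hs ∈ H, ∀ ht ∈ H,
      (∫ x, |h x - y x| ∂ν) ≤
        (∫ x, |h x - y x| ∂μ) + disc
        + (∫ x, |hs x - ht x| ∂ν)
        + (∫ x, |y x - hs x| ∂μ)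
        + (∫ x, |ht x - y x| ∂ν) := by
  intro h hh hs hhs ht hht
  have hbdd : BddAbove {r : ℝ | ∃ h ∈ H, ∃ h' ∈ H,
      r = |(∫ x, |h x - h' x| ∂μ) - (∫ x, |h x - h' x| ∂ν)|} := by
    refine ⟨2 * B, ?_⟩
    rintro r ⟨f, hf, g, hg, rfl⟩
    exact abs_sub_le_of_nonneg_of_le (integral_nonneg fun x => abs_nonneg _)
      (integral_abs_sub_le_two_mul μ (hHmeas f hf) (hHmeas g hg) (hHbd f hf) (hHbd g hg))
      (integral_nonneg fun x => abs_nonneg _)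
      (integral_abs_sub_le_two_mul ν (hHmeas f hf) (hHmeas g hg) (hHbd f hf) (hHbd g hg))
  have hdisc_le : |(∫ x, |h x - hs x| ∂μ) - (∫ x, |h x - hs x| ∂ν)| ≤ disc :=
    hdisc ▸ le_csSup hbdd ⟨h, hh, hs, hhs, rfl⟩
  have hν := integral_abs_sub_triangle ν (hHmeas h hh) (hHmeas hs hhs) hymeas
    (hHbd h hh) (hHbd hs hhs) hybd
  have hν' := integral_abs_sub_triangle ν (hHmeas hs hhs) (hHmeas ht hht) hymeas
    (hHbd hs hhs) (hHbd ht hht) hybd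
  have hμ := integral_abs_sub_triangle μ (hHmeas h hh) hymeas (hHmeas hs hhs)
    (hHbd h hh) hybd (hHbd hs hhs)
  linarith [(abs_le.mp hdisc_le).1]
end
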